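/- Let n be a natural number, let F, H : ℝ → Matrix (Fin n) (Fin n) ℂ be continuous, and let K₁, K₂, K₃ be n×n diagonal matrices with real diagonal entries with the diagonal entries of K₁ positive. Suppose e, eA, eB : ℝ → ℂⁿ are differentiable and satisfy the controlled error dynamics e′(t) = F(t)·eA(t) + H(t)·eB(t) − K₁·e(t) − K₂·eA(t) − K₃·eB(t), eA′(t) = −(F(t))ᴴ·e(t) + K₂·e(t), eB′(t) = −(H(t))ᴴ·e(t) + K₃·e(t), and suppose in addition that e is uniformly continuous on [0, ∞). Then ‖e(t)‖ → 0 as t → ∞, i.e., adaptive synchronization e(t) = y(t) − x(t) → 0 is achieved. -/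

import Mathlib

open Matrix

/-- Matrix–vector multiplication on the Euclidean space `ℂⁿ`. -/
noncomputable def mulVecE {n : ℕ} (M : Matrix (Fin n) (Fin n) ℂ)
    (v : EuclideanSpace ℂ (Fin n)) : EuclideanSpace ℂ (Fin n) :=
  Matrix.toEuclideanLin M v

/-- **Barbalat's lemma** in Lyapunov form: if a nonnegative function decreases at rate at least
`k * ‖e‖ ^ 2` and `e` is uniformly continuous on `[0, ∞)`, then `e` tends to zero. -/
theorem tendsto_norm_zero_of_hasDerivAt_le_neg_norm_sq {E : Type*} [NormedAddCommGroup E]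
    {e : ℝ → E} {V V' : ℝ → ℝ} {k : ℝ} (hk : 0 < k) (hV : ∀ t, HasDerivAt V (V' t) t)
    (hV' : ∀ t, V' t ≤ -(k * ‖e t‖ ^ 2)) (hV0 : ∀ t, 0 ≤ V t)
    (huc : UniformContinuousOn e (Set.Ici 0)) :
    Filter.Tendsto (fun t => ‖e t‖) Filter.atTop (nhds 0) := by
  have hanti : Antitone V := antitone_of_hasDerivAt_nonpos hV fun t =>
    (hV' t).trans (neg_nonpos.mpr (by positivity))
  have hbdd : BddBelow (Set.range V) := ⟨0, by rintro _ ⟨t, rfl⟩; exact hV0 t⟩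
  have hlim := tendsto_atTop_ciInf hanti hbdd
  rw [Metric.tendsto_atTop]
  intro ε hε
  obtain ⟨δ, hδ, hclose⟩ := Metric.uniformContinuousOn_iff.mp huc (ε / 2) (half_pos hε)
  have hdrop : 0 < k * (ε / 2) ^ 2 * (δ / 2) := by positivity
  obtain ⟨T, hT⟩ := Filter.eventually_atTop.mp
    (hlim.eventually_lt_const (lt_add_of_pos_right (⨅ t, V t) hdrop))
  refine ⟨max T 0, fun t ht => ?_⟩
  have htT : T ≤ t := (le_max_left _ _).trans ht
  have ht0 : 0 ≤ t := (le_max_right _ _).trans ht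
  rw [dist_zero_right, norm_norm]
  by_contra! hbig
  have hlow : ∀ s ∈ Set.Icc t (t + δ / 2), ε / 2 ≤ ‖e s‖ := by
    rintro s ⟨hts, hst⟩
    have hdist := hclose t ht0 s (ht0.trans hts) (by
      rw [Real.dist_eq, abs_lt]; constructor <;> linarith)
    rw [dist_eq_norm] at hdist
    linarith [norm_sub_norm_le (e t) (e s)]
  have hmvt := (convex_Icc t (t + δ / 2)).image_sub_le_mul_sub_of_deriv_le
    (f := V) (C := -(k * (ε / 2) ^ 2))
    (fun s _ => (hV s).continuousAt.continuousWithinAt)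
    (fun s _ => (hV s).differentiableAt.differentiableWithinAt)
    (fun s hs => by
      rw [(hV s).deriv]
      refine (hV' s).trans (neg_le_neg ?_)
      gcongr
      exact hlow s (interior_subset hs))
    t ⟨le_rfl, by linarith⟩ (t + δ / 2) ⟨by linarith, le_rfl⟩ (by linarith)
  have hinf := ciInf_le hbdd (t + δ / 2)
  have hlt := hT t htT
  rw [add_sub_cancel_left] at hmvt
  linarith

theorem inner_mulVecE_right {n : ℕ} (M : Matrix (Fin n) (Fin n) ℂ)
    (v w : EuclideanSpace ℂ (Fin n)) :
    inner ℂ v (mulVecE M w) = inner ℂ (mulVecE Mᴴ v) w := by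
  rw [mulVecE, mulVecE, Matrix.toEuclideanLin_conjTranspose_eq_adjoint,
    LinearMap.adjoint_inner_left]

theorem mul_norm_sq_le_re_inner_mulVecE_diagonal {n : ℕ} {d : Fin n → ℝ} {k : ℝ}
    (hk : ∀ i, k ≤ d i) (v : EuclideanSpace ℂ (Fin n)) :
    k * ‖v‖ ^ 2 ≤
      (inner ℂ v (mulVecE (Matrix.diagonal fun i => (d i : ℂ)) v)).re := by
  rw [EuclideanSpace.norm_sq_eq, Finset.mul_sum, PiLp.inner_apply, Complex.re_sum]
  refine Finset.sum_le_sum fun i _ => ?_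
  have hi : (inner ℂ (v i) (mulVecE (Matrix.diagonal fun i => (d i : ℂ)) v i)).re
      = d i * ‖v i‖ ^ 2 := by
    simp only [mulVecE, Matrix.toLpLin_apply, Matrix.mulVec_diagonal, RCLike.inner_apply]
    rw [mul_assoc, Complex.mul_conj, Complex.normSq_eq_norm_sq, ← Complex.ofReal_mul,
      Complex.ofReal_re]
  rw [hi]
  exact mul_le_mul_of_nonneg_right (hk i) (by positivity)

theorem conjTranspose_diagonal_ofReal {n : ℕ} (d : Fin n → ℝ) :
    (Matrix.diagonal fun i => (d i : ℂ))ᴴ = Matrix.diagonal fun i => (d i : ℂ) := by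
  rw [Matrix.diagonal_conjTranspose]
  congr 1
  ext i
  simp

theorem hasDerivAt_half_norm_sq {n : ℕ} {f : ℝ → EuclideanSpace ℂ (Fin n)}
    {f' : EuclideanSpace ℂ (Fin n)} {t : ℝ} (hf : HasDerivAt f f' t) :
    HasDerivAt (fun s => ‖f s‖ ^ 2 / 2) (inner ℂ (f t) f').re t := by
  have h := (Complex.reCLM.hasFDerivAt.comp_hasDerivAt t (hf.inner ℂ hf)).div_const 2
  have hfun : (fun s => ‖f s‖ ^ 2 / 2) = fun s => (inner ℂ (f s) (f s)).re / 2 := by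
    funext s
    exact congrArg (· / 2) (norm_sq_eq_re_inner (𝕜 := ℂ) (f s))
  have hsymm : (inner ℂ f' (f t)).re = (inner ℂ (f t) f').re :=
    inner_re_symm (𝕜 := ℂ) f' (f t)
  have hderiv : (inner ℂ (f t) f').re = (inner ℂ (f t) f' + inner ℂ f' (f t)).re / 2 := by
    rw [Complex.add_re, hsymm]
    ring
  rw [hfun, hderiv]
  exact h

/-- Synchronization conclusion of the adaptive scheme: along solutions of the controlled
error dynamics with the adaptive parameter-update laws, if the synchronization error `e`
is uniformly continuous on `[0, ∞)`, then `‖e(t)‖ → 0` as `t → ∞`. -/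
theorem adaptive_sync_error_tendsto_zero (n : ℕ)
    (F H : ℝ → Matrix (Fin n) (Fin n) ℂ) (hF : Continuous F) (hH : Continuous H)
    (k₁ k₂ k₃ : Fin n → ℝ) (hk₁ : ∀ i, 0 < k₁ i)
    (K₁ K₂ K₃ : Matrix (Fin n) (Fin n) ℂ)
    (hK₁ : K₁ = Matrix.diagonal fun i => (k₁ i : ℂ))
    (hK₂ : K₂ = Matrix.diagonal fun i => (k₂ i : ℂ))
    (hK₃ : K₃ = Matrix.diagonal fun i => (k₃ i : ℂ))
    (e eA eB : ℝ → EuclideanSpace ℂ (Fin n))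
    (hde : ∀ t, HasDerivAt e
      (mulVecE (F t) (eA t) + mulVecE (H t) (eB t)
        - mulVecE K₁ (e t) - mulVecE K₂ (eA t) - mulVecE K₃ (eB t)) t)
    (hdeA : ∀ t, HasDerivAt eA (-(mulVecE (F t)ᴴ (e t)) + mulVecE K₂ (e t)) t)
    (hdeB : ∀ t, HasDerivAt eB (-(mulVecE (H t)ᴴ (e t)) + mulVecE K₃ (e t)) t)
    (huc : UniformContinuousOn e (Set.Ici 0)) :
    Filter.Tendsto (fun t => ‖e t‖) Filter.atTop (nhds 0) := by
  obtain ⟨k, hk, hk_le⟩ : ∃ k : ℝ, 0 < k ∧ ∀ i, k ≤ k₁ i := by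
    rcases isEmpty_or_nonempty (Fin n) with hn | hn
    · exact ⟨1, one_pos, fun i => hn.elim i⟩
    · obtain ⟨i, hi⟩ := Finite.exists_min k₁
      exact ⟨k₁ i, hk₁ i, hi⟩
  refine tendsto_norm_zero_of_hasDerivAt_le_neg_norm_sq hk
    (V := fun t => ‖e t‖ ^ 2 / 2 + ‖eA t‖ ^ 2 / 2 + ‖eB t‖ ^ 2 / 2)
    (fun t => ((hasDerivAt_half_norm_sq (hde t)).add (hasDerivAt_half_norm_sq (hdeA t))).add
      (hasDerivAt_half_norm_sq (hdeB t)))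
    (fun t => ?_) (fun t => by positivity) huc
  have hcross : ∀ (M : Matrix (Fin n) (Fin n) ℂ) (v w : EuclideanSpace ℂ (Fin n)),
      (inner ℂ v (mulVecE M w)).re = (inner ℂ w (mulVecE Mᴴ v)).re := fun M v w => by
    rw [inner_mulVecE_right]
    exact inner_re_symm (𝕜 := ℂ) _ _
  have hdiss := mul_norm_sq_le_re_inner_mulVecE_diagonal hk_le (e t)
  have hA := hcross K₂ (e t) (eA t)
  have hB := hcross K₃ (e t) (eB t)
  rw [hK₂, conjTranspose_diagonal_ofReal, ← hK₂] at hA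
  rw [hK₃, conjTranspose_diagonal_ofReal, ← hK₃] at hB
  rw [← hK₁] at hdiss
  simp only [inner_add_right, inner_sub_right, inner_neg_right, Complex.add_re, Complex.sub_re,
    Complex.neg_re]
  linarith [hcross (F t) (e t) (eA t), hcross (H t) (e t) (eB t)]
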